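/- Let g ≥ 2 be an integer and set n = 4g−4. The number of ordered pairs (c₁, c₂) of n-cycles in the symmetric group on an n-element set such that the product c₁·c₂ is a fixed-point-free involution (a product of n/2 = 2g−2 disjoint transpositions) equals (4g−5)!! · (4g−5)! / (2g−1). -/

import Mathlib

/-- A permutation of `Fin n` is a full `n`-cycle if it is a cycle whose support is
all of `Fin n`. -/
def IsFullCycle {n : ℕ} (σ : Equiv.Perm (Fin n)) : Prop :=
  σ.IsCycle ∧ σ.support = Finset.univ

open Polynomial Equiv

theorem updateRow_comm' {α R : Type*} [DecidableEq α] (C : Matrix α α R) {n j : α} (hnj : n ≠ j)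
    (u v : α → R) : (C.updateRow n u).updateRow j v = (C.updateRow j v).updateRow n u := by
  ext a b
  by_cases h1 : a = j
  · subst h1
    simp [Matrix.updateRow_ne hnj.symm]
  · by_cases h2 : a = n
    · subst h2
      simp [Matrix.updateRow_ne hnj]
    · simp [Matrix.updateRow_ne h1, Matrix.updateRow_ne h2]

theorem two_row_identity {α R : Type*} [Fintype α] [DecidableEq α] [CommRing R]
    (C : Matrix α α R) (n j : α) (hnj : n ≠ j) (e f : α → R) (x y : R) (hxy : x = y + 1) :
    -((C.updateRow n (y • f - x • e + C n)).updateRow j (x • e - x • f + C j)).det =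
      -x * ((C.updateRow n (C n - e)).updateRow j (C j - f)).det
        - y * (C.updateRow n f).det - x * (C.updateRow j e).det + y * C.det := by
  obtain ⟨d, hd⟩ : ∃ d : (α → R) → (α → R) → R,
    d = fun u v => ((C.updateRow n u).updateRow j v).det := ⟨_, rfl⟩
  have hadd2 : ∀ u v w, d u (v + w) = d u v + d u w := by
    intro u v w; subst hd; exact Matrix.det_updateRow_add _ _ _ _
  have hsmul2 : ∀ u (a : R) v, d u (a • v) = a * d u v := by
    intro u a v; subst hd; exact Matrix.det_updateRow_smul _ _ _ _
  have hcomm : ∀ u v, d u v = ((C.updateRow j v).updateRow n u).det := by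
    intro u v; subst hd
    have h : (C.updateRow n u).updateRow j v = (C.updateRow j v).updateRow n u :=
      updateRow_comm' C hnj u v
    simp only [h]
  have hadd1 : ∀ u v w, d (u + v) w = d u w + d v w := by
    intro u v w; simp only [hcomm]; exact Matrix.det_updateRow_add _ _ _ _
  have hsmul1 : ∀ (a : R) u v, d (a • u) v = a * d u v := by
    intro u a v; simp only [hcomm]; exact Matrix.det_updateRow_smul _ _ _ _
  have hself : ∀ u, d u u = 0 := by
    intro u; subst hd
    apply Matrix.det_zero_of_row_eq hnj
    simp [Matrix.updateRow_ne hnj]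
  have hanti : d f e = - d e f := by
    have := hself (e + f)
    rw [hadd1, hadd2, hadd2, hself, hself] at this
    linear_combination this
  have h1 : ∀ u, d u (C j) = (C.updateRow n u).det := by
    intro u; rw [hcomm, Matrix.updateRow_eq_self]
  have h2 : ∀ u, d (C n) u = (C.updateRow j u).det := by
    intro u; subst hd; simp only; rw [Matrix.updateRow_eq_self]
  have h3 : d (C n) (C j) = C.det := by rw [h1, Matrix.updateRow_eq_self]
  have hA : ((C.updateRow n (y • f - x • e + C n)).updateRow j (x • e - x • f + C j)).det
     = d (y • f + (-x) • e + C n) (x • e + (-x) • f + C j) := by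
    subst hd; simp only [neg_smul, sub_eq_add_neg]
  have hB : ((C.updateRow n (C n - e)).updateRow j (C j - f)).det
     = d (C n + (-1:R) • e) (C j + (-1 : R) • f) := by
    subst hd; simp only [neg_smul, sub_eq_add_neg, one_smul]
  rw [hA, hB, ← h1, ← h2]
  simp only [hadd1, hadd2, hsmul1, hsmul2, hself, hanti, h3]
  subst hxy
  ring

theorem derivative_det_col {α : Type*} [Fintype α] [DecidableEq α] (A : Matrix α α ℝ[X]) :
    derivative A.det = ∑ j, (A.updateCol j (fun i => derivative (A i j))).det := by
  simp only [Matrix.det_apply']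
  rw [derivative_sum, Finset.sum_comm]
  refine Finset.sum_congr rfl fun σ _ => ?_
  rw [← Finset.mul_sum, ← Polynomial.C_eq_intCast, derivative_C_mul, derivative_prod_finset]
  congr 1
  refine Finset.sum_congr rfl fun i _ => ?_
  rw [← Finset.prod_erase_mul Finset.univ _ (Finset.mem_univ i)]
  congr 1
  · refine Finset.prod_congr rfl fun k hk => ?_
    rw [Matrix.updateCol_ne (Finset.ne_of_mem_erase hk)]
  · simp

theorem derivative_det_row {α : Type*} [Fintype α] [DecidableEq α] (A : Matrix α α ℝ[X]) :
    derivative A.det = ∑ j, (A.updateRow j (fun i => derivative (A j i))).det := by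
  rw [← Matrix.det_transpose, derivative_det_col]
  refine Finset.sum_congr rfl fun j _ => ?_
  rw [← Matrix.det_transpose, Matrix.updateCol_transpose, Matrix.transpose_transpose]
  rfl


/-- The matrix `x - y M_π`, with `x = X`, `y = X - 1`. -/
noncomputable def cmat {α : Type*} [DecidableEq α] (π : Perm α) : Matrix α α ℝ[X] :=
  Matrix.of fun a => (X : ℝ[X]) • (Pi.single a 1 : α → ℝ[X])
    - (X - 1 : ℝ[X]) • (Pi.single (π a) 1 : α → ℝ[X])

theorem cmat_row {α : Type*} [DecidableEq α] (π : Perm α) (a : α) :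
   cmat π a = (X : ℝ[X]) • (Pi.single a 1 : α → ℝ[X])
    - (X - 1 : ℝ[X]) • (Pi.single (π a) 1 : α → ℝ[X]) := rfl

theorem deriv_row {α : Type*} [DecidableEq α] (π : Perm α) (a : α) :
   (fun i => derivative (cmat π a i)) =
     (Pi.single a 1 : α → ℝ[X]) - (Pi.single (π a) 1 : α → ℝ[X]) := by
  ext1 i
  simp only [cmat_row, Pi.sub_apply, Pi.smul_apply, smul_eq_mul, Pi.single_apply]
  split_ifs <;> simp

theorem smul_deriv_row {α : Type*} [DecidableEq α] (π : Perm α) (a : α) :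
   (X - 1 : ℝ[X]) • ((Pi.single a 1 : α → ℝ[X]) - (Pi.single (π a) 1 : α → ℝ[X])) =
     cmat π a - (Pi.single a 1 : α → ℝ[X]) := by
  rw [cmat_row]; module

theorem sum_updateRow_single {α : Type*} [Fintype α] [DecidableEq α] (π : Perm α) (o : α) :
    ∑ j, ((cmat π).updateRow o (Pi.single j 1)).det = (cmat π).det := by
  have h : ∀ j, ((cmat π).updateRow o (Pi.single j 1)).det = (cmat π).adjugate j o := by
    intro j; rw [Matrix.adjugate_apply]
  simp only [h]
  have h1 : Matrix.vecMul (fun _ => 1) (cmat π) = fun _ => 1 := by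
    ext1 i
    have : ∑ a, (Pi.single (π a) 1 : α → ℝ[X]) i = 1 := by
      rw [Equiv.sum_comp π (fun a => (Pi.single a 1 : α → ℝ[X]) i)]
      simp [Pi.single_apply]
    simp only [Matrix.vecMul, dotProduct, cmat_row, Pi.sub_apply, Pi.smul_apply, smul_eq_mul,
      one_mul, Finset.sum_sub_distrib, ← Finset.mul_sum, this]
    simp [Pi.single_apply]
  have h2 := congrArg (fun v => Matrix.vecMul v (cmat π).adjugate o) h1
  simp only [Matrix.vecMul_vecMul, Matrix.mul_adjugate, Matrix.vecMul_smul, Matrix.vecMul_one] at h2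
  simpa [Matrix.vecMul, dotProduct] using h2.symm

theorem sum_updateRow_single' {α : Type*} [Fintype α] [DecidableEq α] (π : Perm α) (o : α) :
    ∑ j, ((cmat π).updateRow j (Pi.single o 1)).det = (cmat π).det := by
  have h : ∀ j, ((cmat π).updateRow j (Pi.single o 1)).det = (cmat π).adjugate o j := by
    intro j; rw [Matrix.adjugate_apply]
  simp only [h]
  have h1 : (cmat π).mulVec (fun _ => 1) = fun _ => 1 := by
    ext1 i
    simp only [Matrix.mulVec, dotProduct, cmat_row, Pi.sub_apply, Pi.smul_apply, smul_eq_mul,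
      mul_one, Finset.sum_sub_distrib, ← Finset.mul_sum]
    simp [Pi.single_apply]
  have h2 := congrArg (fun v => (cmat π).adjugate.mulVec v o) h1
  simp only [Matrix.mulVec_mulVec, Matrix.adjugate_mul, Matrix.smul_mulVec, Matrix.one_mulVec] at h2
  simpa [Matrix.mulVec, dotProduct] using h2.symm

/-- The matrix appearing in the recursion. -/
noncomputable def zmat {α : Type*} [DecidableEq α] (π : Perm α) (o j : α) : Matrix α α ℝ[X] :=
  ((cmat π).updateRow o ((Pi.single j 1 : α → ℝ[X]) - (Pi.single (π o) 1 : α → ℝ[X]))).updateRow j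
    ((X : ℝ[X]) • (Pi.single o 1 : α → ℝ[X]) - (X - 1 : ℝ[X]) • (Pi.single (π j) 1 : α → ℝ[X]))

theorem zmat_step {α : Type*} [Fintype α] [DecidableEq α] (π : Perm α) (o j : α) (h : o ≠ j) :
    (X - 1) * -(zmat π o j).det =
      -X * (((cmat π).updateRow o (cmat π o - Pi.single o 1)).updateRow j
          (cmat π j - Pi.single j 1)).det
        - (X - 1) * ((cmat π).updateRow o (Pi.single j 1)).det
        - X * ((cmat π).updateRow j (Pi.single o 1)).det + (X - 1) * (cmat π).det := by
  rw [← two_row_identity (cmat π) o j h _ _ X (X - 1) (by ring), mul_neg, zmat,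
    updateRow_comm' _ h, ← Matrix.det_updateRow_smul, updateRow_comm' _ h]
  congr 4
  · rw [cmat_row]; module
  · rw [cmat_row]; module

theorem main_poly {α : Type*} [Fintype α] [DecidableEq α] (π : Perm α) (o : α) :
    -∑ j ∈ Finset.univ.erase o, (zmat π o j).det =
      ((Fintype.card α : ℝ[X]) - 1) * (cmat π).det -
        derivative (X * ((cmat π).det - ((cmat π).updateRow o (Pi.single o 1)).det)) := by
  have hy : (X - 1 : ℝ[X]) ≠ 0 := by
    have := Polynomial.X_sub_C_ne_zero (1 : ℝ)
    simpa using this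
  apply mul_left_cancel₀ hy
  rw [← Finset.sum_neg_distrib, Finset.mul_sum,
    Finset.sum_congr rfl (fun j hj => zmat_step π o j (Finset.ne_of_mem_erase hj).symm)]
  have e1 := sum_updateRow_single π o
  have e2 := sum_updateRow_single' π o
  rw [← Finset.add_sum_erase _ _ (Finset.mem_univ o)] at e1 e2
  rw [Finset.sum_add_distrib, Finset.sum_sub_distrib, Finset.sum_sub_distrib, ← Finset.mul_sum,
    ← Finset.mul_sum, ← Finset.mul_sum, Finset.sum_const, Finset.card_erase_of_mem (Finset.mem_univ o),
    Finset.card_univ]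
  have hcard : ((Fintype.card α - 1 : ℕ) : ℝ[X]) = (Fintype.card α : ℝ[X]) - 1 := by
    have : 1 ≤ Fintype.card α := Fintype.card_pos_iff.mpr ⟨o⟩
    push_cast [Nat.cast_sub this]; ring
  rw [nsmul_eq_mul, hcard]
  have hD : (X - 1) * derivative (cmat π).det =
      (cmat π).det - ((cmat π).updateRow o (Pi.single o 1)).det +
      ∑ j ∈ Finset.univ.erase o, ((cmat π).updateRow j (cmat π j - Pi.single j 1)).det := by
    rw [derivative_det_row, Finset.mul_sum]
    simp only [deriv_row, ← Matrix.det_updateRow_smul, smul_deriv_row]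
    rw [← Finset.add_sum_erase _ _ (Finset.mem_univ o)]
    congr 1
    rw [sub_eq_add_neg, ← neg_one_smul ℝ[X], Matrix.det_updateRow_add, Matrix.det_updateRow_smul,
      Matrix.updateRow_eq_self]
    ring
  have hm : (X - 1) * derivative ((cmat π).updateRow o (Pi.single o 1)).det =
      ∑ j ∈ Finset.univ.erase o, (((cmat π).updateRow o (Pi.single o 1)).updateRow j
        (cmat π j - Pi.single j 1)).det := by
    rw [derivative_det_row, Finset.mul_sum, ← Finset.add_sum_erase _ _ (Finset.mem_univ o)]
    have h0 : (fun i => derivative ((cmat π).updateRow o (Pi.single o 1) o i)) = 0 := by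
      ext1 i
      simp only [Matrix.updateRow_self, Pi.single_apply, Pi.zero_apply]
      split_ifs <;> simp
    rw [h0, Matrix.det_eq_zero_of_row_eq_zero o (by simp), mul_zero, zero_add]
    refine Finset.sum_congr rfl fun j hj => ?_
    rw [Matrix.updateRow_ne (Finset.ne_of_mem_erase hj), deriv_row, ← Matrix.det_updateRow_smul,
      smul_deriv_row]
  have hS : ∑ j ∈ Finset.univ.erase o, (((cmat π).updateRow o (cmat π o - Pi.single o 1)).updateRow j
          (cmat π j - Pi.single j 1)).det =
      ∑ j ∈ Finset.univ.erase o, ((cmat π).updateRow j (cmat π j - Pi.single j 1)).det -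
      ∑ j ∈ Finset.univ.erase o, (((cmat π).updateRow o (Pi.single o 1)).updateRow j
        (cmat π j - Pi.single j 1)).det := by
    rw [← Finset.sum_sub_distrib]
    refine Finset.sum_congr rfl fun j hj => ?_
    have hj' := (Finset.ne_of_mem_erase hj).symm
    rw [updateRow_comm' _ hj', updateRow_comm' _ hj', sub_eq_add_neg (cmat π o),
      ← neg_one_smul ℝ[X], Matrix.det_updateRow_add, Matrix.det_updateRow_smul]
    rw [← updateRow_comm' _ hj' (cmat π o), Matrix.updateRow_eq_self]
    ring
  rw [hS, derivative_mul, derivative_X, derivative_sub]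
  linear_combination (-(X - 1 : ℝ[X])) * e1 - X * e2 + X * hD - X * hm

theorem zmat_swap {α : Type*} [Fintype α] [DecidableEq α] (π : Perm α) (o j : α) (h : o ≠ j) :
    -(zmat π o j).det = ((cmat (swap o j * π)).updateRow o
      ((Pi.single o 1 : α → ℝ[X]) - (Pi.single ((swap o j * π) o) 1 : α → ℝ[X]))).det := by
  have hs := Matrix.det_permute' (swap o j) (zmat π o j)
  rw [Perm.sign_swap h] at hs
  have : -(zmat π o j).det = ((zmat π o j).submatrix id (swap o j)).det := by
    rw [hs]; simp
  rw [this]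
  have key : ∀ a b : α, (Pi.single a 1 : α → ℝ[X]) (swap o j b) =
      (Pi.single (swap o j a) 1 : α → ℝ[X]) b := by
    intro a b
    simp only [Pi.single_apply]
    congr 1
    rw [eq_iff_iff]
    constructor
    · rintro rfl; simp
    · rintro rfl; simp
  congr 1
  ext1 a b
  simp only [Matrix.submatrix_apply, id, zmat]
  by_cases haj : a = j
  · subst haj
    rw [Matrix.updateRow_self, Matrix.updateRow_ne h.symm, cmat_row]
    simp only [Pi.sub_apply, Pi.smul_apply, key]
    simp
  · rw [Matrix.updateRow_ne haj]
    by_cases hao : a = o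
    · subst hao
      rw [Matrix.updateRow_self, Matrix.updateRow_self]
      simp only [Pi.sub_apply, key]
      simp
    · rw [Matrix.updateRow_ne hao, Matrix.updateRow_ne hao, cmat_row, cmat_row]
      simp only [Pi.sub_apply, Pi.smul_apply, key]
      rw [swap_apply_of_ne_of_ne hao haj]
      simp

theorem det_removeNone {α : Type*} [Fintype α] [DecidableEq α] (σ : Perm (Option α)) :
    ((cmat σ).updateRow none ((Pi.single none 1 : Option α → ℝ[X]) -
        (Pi.single (σ none) 1 : Option α → ℝ[X]))).det =
      if σ none = none then 0 else (cmat (removeNone σ)).det := by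
  split_ifs with h
  · apply Matrix.det_eq_zero_of_row_eq_zero none
    simp [h]
  · rw [← Matrix.det_reindex_self (Equiv.optionEquivSumPUnit.{0} α)]
    set Z := (cmat σ).updateRow none ((Pi.single none 1 : Option α → ℝ[X]) -
        (Pi.single (σ none) 1 : Option α → ℝ[X])) with hZ
    have hb : Matrix.reindex (Equiv.optionEquivSumPUnit.{0} α) (Equiv.optionEquivSumPUnit.{0} α) Z =
      Matrix.fromBlocks (Matrix.of fun a b => Z (some a) (some b))
        (Matrix.of fun a (_ : PUnit.{1}) => Z (some a) none)
        (Matrix.of fun (_ : PUnit.{1}) b => Z none (some b)) 1 := by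
      ext1 a b
      rcases a with a | a <;> rcases b with b | b
      · simp
      · simp
      · simp
      · simp [hZ, Pi.single_apply, Ne.symm h]
    rw [hb, Matrix.det_fromBlocks_one₂₂]
    congr 1
    ext1 a b
    obtain ⟨c, hc⟩ := Option.ne_none_iff_exists'.mp h
    have hsn : some (removeNone σ a) = if σ (some a) = none then σ none else σ (some a) := by
      split_ifs with h'
      · exact removeNone_none _ h'
      · exact removeNone_some _ (Option.ne_none_iff_exists'.mp h')
    simp only [Matrix.sub_apply, Matrix.mul_apply, Matrix.of_apply, hZ, cmat_row,
      Finset.univ_unique, Finset.sum_singleton, ne_eq, reduceCtorEq, not_false_eq_true,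
      Matrix.updateRow_ne, Matrix.updateRow_self, Pi.sub_apply, Pi.smul_apply, smul_eq_mul,
      Pi.single_apply, hc, Option.some.injEq]
    have h2 : (b = removeNone σ a) ↔ some b = some (removeNone σ a) := by simp
    simp only [h2, hsn]
    by_cases h' : σ (some a) = none
    · simp only [h', hc, if_true, reduceCtorEq, if_false, Option.some.injEq]
      split_ifs <;> ring
    · simp [h', Ne.symm h']

/-- `σ` has a single orbit. -/
def Full {α : Type*} (σ : Perm α) : Prop :=
  ∀ f : α → Prop, (∀ a, f (σ a) ↔ f a) → ∀ a b, f a → f b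

theorem full_inv {α : Type*} (σ : Perm α) : Full σ⁻¹ ↔ Full σ := by
  have h : ∀ τ : Perm α, Full τ → Full τ⁻¹ := by
    intro τ hτ f hf
    apply hτ f
    intro a
    have := hf (τ a)
    have h2 : τ⁻¹ (τ a) = a := τ.symm_apply_apply a
    rw [h2] at this
    exact this.symm
  exact ⟨fun hh => by simpa using h _ hh, h σ⟩

theorem full_swap_option {α : Type*} [DecidableEq α] (s : Perm α) (b : α) :
    Full (swap none (some b) * s.optionCongr) ↔ Full s := by
  have hn : (swap none (some b) * s.optionCongr) none = some b := by simp
  have hs : ∀ a, (swap none (some b) * s.optionCongr) (some a) =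
      if s a = b then none else some (s a) := by
    intro a
    split_ifs with h
    · simp [h]
    · simp only [Perm.mul_apply, optionCongr_apply, Option.map_some]
      exact swap_apply_of_ne_of_ne (by simp) (by simpa using h)
  constructor
  · intro H f hf a c hac
    have := H (fun o => o.elim (f b) f) (by
      rintro (_ | a)
      · rw [hn]; rfl
      · rw [hs]
        split_ifs with h
        · simp only [Option.elim]; rw [← hf a, h]
        · simp only [Option.elim]; exact hf a) (some a) (some c)
    exact this hac
  · intro H f hf
    have hb : f (some b) ↔ f none := by rw [← hf none, hn]
    have H' := H (fun a => f (some a)) (by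
      intro a
      have := hf (some a)
      rw [hs] at this
      split_ifs at this with h
      · rw [h, hb, this]
      · exact this)
    rintro (_ | a) (_ | c) hh
    · exact hh
    · exact H' b c (hb.2 hh)
    · exact hb.1 (H' a b hh)
    · exact H' a c hh

theorem not_full_option {α : Type*} [Nonempty α] (s : Perm α) : ¬ Full s.optionCongr := by
  intro H
  have := H (fun o => o = none) (by rintro (_ | a) <;> simp) none (some (Classical.arbitrary α)) rfl
  simp at this

open Classical in
/-- Number of factorizations of `π` into two full cycles. -/
noncomputable def Nfac {α : Type*} [Fintype α] [DecidableEq α] (π : Perm α) : ℕ :=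
  (Finset.univ.filter fun c : Perm α => Full c ∧ Full (c⁻¹ * π)).card

theorem optionCongr_mul' {α : Type*} (s t : Perm α) :
    (s * t).optionCongr = s.optionCongr * t.optionCongr := by
  ext1 (_ | a) <;> simp

theorem full_step {α : Type*} [DecidableEq α] [Nonempty α] (c : Perm α) (σ : Perm (Option α)) :
    Full (c⁻¹.optionCongr * σ) ↔ σ none ≠ none ∧ Full (c⁻¹ * removeNone σ) := by
  have hσ : σ = swap none (σ none) * (removeNone σ).optionCongr := by
    rw [map_equiv_removeNone, ← mul_assoc, swap_mul_self, one_mul]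
  by_cases h : σ none = none
  · have : σ = (removeNone σ).optionCongr := by
      rw [h, swap_self] at hσ
      exact hσ
    rw [this, ← optionCongr_mul']
    simp [not_full_option]
  · obtain ⟨b, hb⟩ := Option.ne_none_iff_exists'.mp h
    have : c⁻¹.optionCongr * σ =
        swap none (some (c⁻¹ b)) * (c⁻¹ * removeNone σ).optionCongr := by
      conv_lhs => rw [hσ, hb]
      rw [optionCongr_mul', ← mul_assoc, ← mul_assoc]
      congr 1
      rw [Equiv.mul_swap_eq_swap_mul]
      simp
    rw [this, full_swap_option]
    simp [h]

theorem Nfac_option {α : Type*} [Fintype α] [DecidableEq α] [Nonempty α] (π : Perm (Option α)) :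
    Nfac π = ∑ b : α, if (swap none (some b) * π) none = none then 0 else
      Nfac (removeNone (swap none (some b) * π)) := by
  classical
  have h1 : Nfac π = ∑ p : Option α × Perm α,
      if Full (Perm.decomposeOption.symm p) ∧ Full ((Perm.decomposeOption.symm p)⁻¹ * π)
        then 1 else 0 := by
    rw [Nfac, Finset.card_filter, ← Equiv.sum_comp Perm.decomposeOption.symm]
  rw [h1, Fintype.sum_prod_type, Fintype.sum_option]
  have h0 : ∀ c : Perm α, ¬ Full (Perm.decomposeOption.symm (none, c)) := by
    intro c
    rw [Perm.decomposeOption_symm_apply]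
    simp only [swap_self]
    exact not_full_option c
  simp only [h0, false_and, if_false, Finset.sum_const_zero, zero_add]
  refine Finset.sum_congr rfl fun b _ => ?_
  have h2 : ∀ c : Perm α, (Full (Perm.decomposeOption.symm (some b, c)) ∧
      Full ((Perm.decomposeOption.symm (some b, c))⁻¹ * π)) ↔
      (Full c ∧ (swap none (some b) * π) none ≠ none ∧
        Full (c⁻¹ * removeNone (swap none (some b) * π))) := by
    intro c
    rw [← full_step, Perm.decomposeOption_symm_apply]
    simp only
    rw [full_swap_option, mul_inv_rev, swap_inv, mul_assoc]
    rfl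
  simp only [h2]
  split_ifs with h
  · simp [h]
  · rw [Nfac, Finset.card_filter]
    simp only [ne_eq, h, not_false_eq_true, true_and]

/-- integral functional -/
noncomputable def Int01 (p : ℝ[X]) : ℝ := ∫ t in (0:ℝ)..1, p.eval t

theorem Int01_sub (p q : ℝ[X]) : Int01 (p - q) = Int01 p - Int01 q := by
  simp only [Int01, eval_sub]
  exact intervalIntegral.integral_sub (p.continuous.intervalIntegrable _ _)
    (q.continuous.intervalIntegrable _ _)

theorem Int01_sum {ι : Type*} (s : Finset ι) (p : ι → ℝ[X]) :
    Int01 (∑ i ∈ s, p i) = ∑ i ∈ s, Int01 (p i) := by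
  simp only [Int01, eval_finsetSum]
  exact intervalIntegral.integral_finsetSum fun i _ => ((p i).continuous.intervalIntegrable _ _)

theorem Int01_natCast_mul (k : ℕ) (p : ℝ[X]) : Int01 ((k : ℝ[X]) * p) = k * Int01 p := by
  simp [Int01, eval_mul]

theorem Int01_derivative (p : ℝ[X]) : Int01 (derivative p) = p.eval 1 - p.eval 0 := by
  rw [Int01]
  exact intervalIntegral.integral_eq_sub_of_hasDerivAt (fun x _ => p.hasDerivAt x)
    ((derivative p).continuous.intervalIntegrable _ _)

theorem eval_one_det {α : Type*} [Fintype α] [DecidableEq α] (π : Perm α) (o : α) :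
    ((cmat π).det - ((cmat π).updateRow o (Pi.single o 1)).det).eval 1 = 0 := by
  have h1 : ∀ A : Matrix α α ℝ[X], A.det.eval 1 = (A.map (eval 1)).det := by
    intro A
    have := RingHom.map_det (evalRingHom (1:ℝ)) A
    simpa using this
  rw [eval_sub, h1, h1, sub_eq_zero]
  congr 1
  ext1 a b
  by_cases ha : a = o
  · subst ha
    simp only [Matrix.map_apply, Matrix.updateRow_self, cmat_row, Pi.sub_apply, Pi.smul_apply]
    simp
  · simp only [Matrix.map_apply, Matrix.updateRow_ne ha]

theorem card_step {α : Type*} [Fintype α] [DecidableEq α] [Nonempty α]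
    (ih : ∀ π : Perm α, (Nfac π : ℝ) = (Fintype.card α - 1).factorial * Int01 (cmat π).det)
    (π : Perm (Option α)) :
    (Nfac π : ℝ) = (Fintype.card α).factorial * Int01 (cmat π).det := by
  have hm := congrArg Int01 (main_poly π none)
  have hc : (Fintype.card (Option α) : ℝ[X]) - 1 = (Fintype.card α : ℕ) := by
    rw [Fintype.card_option]; push_cast; ring
  rw [Int01_sub, Int01_derivative, hc, Int01_natCast_mul, eval_mul, eval_mul, eval_one_det, eval_X,
    eval_X, ← Finset.sum_neg_distrib, Int01_sum] at hm
  have hset : (Finset.univ : Finset (Option α)).erase none = Finset.univ.map Function.Embedding.some := by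
    ext (_ | a) <;> simp
  rw [hset, Finset.sum_map] at hm
  have hpos : Fintype.card α ≠ 0 := Fintype.card_ne_zero
  rw [Nfac_option, ← Nat.mul_factorial_pred hpos]
  rw [Nat.cast_sum, Nat.cast_mul, mul_comm (Fintype.card α : ℝ), mul_assoc]
  have : (Fintype.card α : ℝ) * Int01 (cmat π).det = ∑ b : α,
     Int01 (-(zmat π none (some b)).det) := by
    rw [← sub_zero (_ * _)]
    simpa using hm.symm
  rw [this, Finset.mul_sum]
  refine Finset.sum_congr rfl fun b _ => ?_
  rw [zmat_swap _ _ _ (by simp), det_removeNone]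
  split_ifs with h
  · simp [Int01]
  · exact ih _

theorem Full_congr {α β : Type*} (e : α ≃ β) (π : Perm α) : Full (e.permCongr π) ↔ Full π := by
  constructor
  · intro H f hf a b hab
    have := H (fun x => f (e.symm x)) (by intro x; simp [hf]) (e a) (e b)
    simpa [hab] using this
  · intro H f hf a b hab
    have := H (fun x => f (e x)) (by intro x; have := hf (e x); simpa using this) (e.symm a) (e.symm b)
    simpa [hab] using this

theorem Nfac_congr {α β : Type*} [Fintype α] [DecidableEq α] [Fintype β] [DecidableEq β]
    (e : α ≃ β) (π : Perm α) : Nfac (e.permCongr π) = Nfac π := by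
  classical
  rw [Nfac, Nfac, Finset.card_filter, Finset.card_filter, ← Equiv.sum_comp e.permCongr]
  refine Finset.sum_congr rfl fun c _ => ?_
  have : (e.permCongr c)⁻¹ * e.permCongr π = e.permCongr (c⁻¹ * π) := by
    rw [inv_mul_eq_iff_eq_mul]
    ext1 x
    have : c (c⁻¹ (π (e.symm x))) = π (e.symm x) := c.apply_symm_apply _
    simp only [Perm.mul_apply, Equiv.permCongr_apply, Equiv.symm_apply_apply, this]
  rw [this, Full_congr, Full_congr]

theorem cmat_congr {α β : Type*} [Fintype α] [DecidableEq α] [Fintype β] [DecidableEq β]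
    (e : α ≃ β) (π : Perm α) : (cmat (e.permCongr π)).det = (cmat π).det := by
  rw [← Matrix.det_reindex_self e]
  congr 1
  ext1 a b
  simp [cmat_row, Pi.single_apply, Equiv.symm_apply_eq]

theorem boccara_fin (n : ℕ) : ∀ π : Perm (Fin (n + 1)),
    (Nfac π : ℝ) = n.factorial * Int01 (cmat π).det := by
  induction n with
  | zero =>
    rw [zero_add]
    intro π
    have h1 : Nfac π = 1 := by
      classical
      rw [Nfac, Finset.filter_true_of_mem]
      · simp
      · intro c _
        constructor <;>
        · intro f hf a b hab
          rwa [Subsingleton.elim b a]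
    have h2 : (cmat π).det = 1 := by
      rw [Matrix.det_unique, cmat_row]
      have h0 : π default = default := Subsingleton.elim _ _
      rw [h0]
      simp
    rw [h1, h2]
    simp [Int01]
  | succ n ih =>
    intro π
    have := card_step (α := Fin (n + 1)) (by simpa using ih) ((finSuccEquiv (n + 1)).permCongr π)
    rw [Nfac_congr, cmat_congr] at this
    simpa using this

theorem full_iff {n : ℕ} (hn : 2 ≤ n) (σ : Perm (Fin n)) : IsFullCycle σ ↔ Full σ := by
  have : Nontrivial (Fin n) := Fin.nontrivial_iff_two_le.mpr hn
  constructor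
  · rintro ⟨hc, hs⟩ f hf a b hab
    have hmem : ∀ x, σ x ≠ x := fun x => by
      rw [← Perm.mem_support, hs]; exact Finset.mem_univ x
    obtain ⟨i, hi⟩ := hc.exists_pow_eq (hmem a) (hmem b)
    have : ∀ i : ℕ, f ((σ ^ i) a) := by
      intro i
      induction i with
      | zero => simpa using hab
      | succ i ih => rw [pow_succ', Perm.mul_apply, hf]; exact ih
    rw [← hi]; exact this i
  · intro H
    have hmem : ∀ x, σ x ≠ x := by
      intro x hx
      obtain ⟨y, hy⟩ := exists_ne x
      refine hy (H (fun z => z = x) ?_ x y rfl)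
      intro a
      constructor
      · intro h; exact σ.injective (h.trans hx.symm)
      · rintro rfl; exact hx
    refine ⟨?_, ?_⟩
    · refine ⟨⟨0, by omega⟩, hmem _, fun y _ => ?_⟩
      refine H (fun z => σ.SameCycle ⟨0, by omega⟩ z) ?_ _ y (Perm.SameCycle.refl _ _)
      intro a
      exact Perm.sameCycle_apply_right
    · ext x
      simpa using hmem x

/-- the model fixed point free involution -/
def modelInv (m : ℕ) : Perm (Fin 2 × Fin m) := Equiv.prodCongr (swap 0 1) (Equiv.refl _)

theorem det_modelInv (m : ℕ) : (cmat (modelInv m)).det = (2 * X - 1) ^ m := by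
  have : cmat (modelInv m) =
      Matrix.blockDiagonal (fun _ : Fin m => !![(X : ℝ[X]), -(X - 1); -(X - 1), X]) := by
    ext1 ⟨a, k⟩ ⟨b, l⟩
    rw [Matrix.blockDiagonal_apply, cmat_row]
    simp only [Pi.sub_apply, Pi.smul_apply, Pi.single_apply, modelInv, prodCongr_apply,
      Prod.map, Prod.mk.injEq, refl_apply, smul_eq_mul]
    by_cases hkl : k = l
    · subst hkl
      fin_cases a <;> fin_cases b <;> simp
    · simp [hkl, Ne.symm hkl]
  rw [this, Matrix.det_blockDiagonal]
  simp only [Matrix.det_fin_two_of, Finset.prod_const, Finset.card_univ, Fintype.card_fin]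
  congr 1
  ring

theorem cycleType_model {n m : ℕ} (hn : n = 2 * m) (e : Fin 2 × Fin m ≃ Fin n) :
    (e.permCongr (modelInv m)).cycleType = Multiset.replicate m 2 := by
  have : Fact (Nat.Prime 2) := ⟨Nat.prime_two⟩
  have h2 : (e.permCongr (modelInv m)) ^ 2 = 1 := by
    ext1 x
    simp [pow_two, modelInv, Prod.map]
  have hs : (e.permCongr (modelInv m)).support = Finset.univ := by
    ext x
    obtain ⟨⟨a, k⟩, rfl⟩ := e.surjective x
    simp only [Perm.mem_support, permCongr_apply, symm_apply_apply, ne_eq, e.injective.eq_iff,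
      modelInv, Finset.mem_univ, iff_true, prodCongr_apply, Prod.map, Prod.mk.injEq]
    fin_cases a <;> simp
  have h3 := Perm.cycleType_of_pow_prime_eq_one h2
  have h4 := Perm.sum_cycleType (e.permCongr (modelInv m))
  rw [hs, Finset.card_univ, Fintype.card_fin, h3, Multiset.sum_replicate, smul_eq_mul] at h4
  rw [h3]
  congr 1
  omega

theorem det_invol {n m : ℕ} (hn : n = 2 * m) (τ : Perm (Fin n))
    (hτ : τ.cycleType = Multiset.replicate m 2) : (cmat τ).det = (2 * X - 1) ^ m := by
  have e : Fin 2 × Fin m ≃ Fin n := finProdFinEquiv.trans (finCongr hn.symm)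
  have hc : IsConj τ (e.permCongr (modelInv m)) := by
    rw [Perm.isConj_iff_cycleType_eq, hτ, cycleType_model hn]
  obtain ⟨c, hc⟩ := isConj_iff.mp hc
  have h1 : Equiv.permCongr c τ = e.permCongr (modelInv m) := by
    rw [← hc]; rfl
  rw [← det_modelInv, ← cmat_congr e, ← h1, cmat_congr]

theorem int_even (m : ℕ) (hm : Even m) : Int01 ((2 * X - 1) ^ m) = 1 / (m + 1) := by
  have hsub := Int01_derivative (C (1 / (2 * (m + 1) : ℝ)) * (2 * X - 1) ^ (m + 1))
  have hd : derivative (C (1 / (2 * (m + 1) : ℝ)) * (2 * X - 1) ^ (m + 1)) = (2 * X - 1) ^ m := by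
    have h2 : derivative (2 * X - 1 : ℝ[X]) = C 2 := by
      rw [derivative_sub, derivative_one, sub_zero]
      have : (2 : ℝ[X]) = C 2 := (map_ofNat C 2).symm
      rw [this, derivative_C_mul, derivative_X, mul_one]
    rw [derivative_C_mul, derivative_pow_succ, h2]
    rw [mul_assoc, mul_comm ((2 * X - 1) ^ m), ← mul_assoc, ← mul_assoc, ← C_mul, ← C_mul]
    have : (1 / (2 * (m + 1) : ℝ)) * (m + 1) * 2 = 1 := by
      have : (m + 1 : ℝ) ≠ 0 := by positivity
      field_simp
    rw [this]; simp
  rw [hd] at hsub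
  rw [hsub]
  have h1 : (-1 : ℝ) ^ (m + 1) = -1 := hm.add_one.neg_one_pow
  have : (m + 1 : ℝ) ≠ 0 := by positivity
  simp only [eval_mul, eval_C, eval_pow, eval_sub, eval_X, eval_one, eval_ofNat]
  norm_num [h1]
  field_simp
  norm_num

theorem count_invol {n m : ℕ} (hm : 1 ≤ m) (hn : n = 2 * m) :
    ((Finset.univ : Finset (Perm (Fin n))).filter
      fun τ => τ.cycleType = Multiset.replicate m 2).card = (n - 1).doubleFactorial := by
  have h := Perm.card_of_cycleType_mul_eq (Fin n) (Multiset.replicate m 2)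
  rw [if_pos] at h
  · rw [Multiset.sum_replicate, Fintype.card_fin, Multiset.prod_replicate,
      Multiset.toFinset_replicate, if_neg (by omega), Finset.prod_singleton,
      Multiset.count_replicate_self, smul_eq_mul, mul_comm m, ← hn, Nat.sub_self, Nat.factorial_zero,
      one_mul] at h
    have h1 := Nat.factorial_eq_mul_doubleFactorial (n - 1)
    have h2 : n - 1 + 1 = n := by omega
    rw [h2] at h1
    have h3 := Nat.doubleFactorial_two_mul m
    rw [← hn] at h3
    rw [h1, h3, mul_comm (2 ^ m * _)] at h
    exact Nat.eq_of_mul_eq_mul_right (by positivity) h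
  · constructor
    · simp [hn, mul_comm]
    · intro a ha
      rw [Multiset.eq_of_mem_replicate ha]

theorem count_general (n m : ℕ) (hm : 1 ≤ m) (hev : Even m) (hn : n = 2 * m) :
    (Nat.card {p : Perm (Fin n) × Perm (Fin n) //
        IsFullCycle p.1 ∧ IsFullCycle p.2 ∧
          (p.1 * p.2).cycleType = Multiset.replicate m 2} : ℝ) =
      (Nat.doubleFactorial (n - 1) : ℝ) * (Nat.factorial (n - 1) : ℝ) / (m + 1) := by
  classical
  have hN : ∀ τ : Perm (Fin n), τ.cycleType = Multiset.replicate m 2 →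
      (Nfac τ : ℝ) = (n - 1).factorial / (m + 1) := by
    intro τ hτ
    have hd := det_invol hn τ hτ
    obtain ⟨k, rfl⟩ : ∃ k, n = k + 1 := ⟨n - 1, by omega⟩
    rw [boccara_fin, hd, int_even m hev]
    simp [div_eq_mul_inv]
  have h1 : Nat.card {p : Perm (Fin n) × Perm (Fin n) //
        IsFullCycle p.1 ∧ IsFullCycle p.2 ∧
          (p.1 * p.2).cycleType = Multiset.replicate m 2} =
      ∑ τ ∈ (Finset.univ : Finset (Perm (Fin n))).filter
        (fun τ => τ.cycleType = Multiset.replicate m 2), Nfac τ := by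
    have hn2 : 2 ≤ n := by omega
    simp only [full_iff hn2]
    rw [Nat.card_eq_fintype_card, Fintype.card_subtype, Finset.card_filter,
      Fintype.sum_prod_type, Finset.sum_filter]
    have hf : ∀ c : Perm (Fin n), (∑ d : Perm (Fin n), if Full c ∧ Full d ∧
        (c * d).cycleType = Multiset.replicate m 2 then 1 else 0) =
        ∑ τ : Perm (Fin n), if Full c ∧ Full (c⁻¹ * τ) ∧
        τ.cycleType = Multiset.replicate m 2 then 1 else 0 := by
      intro c
      symm
      rw [← Equiv.sum_comp (Equiv.mulLeft c)]
      refine Finset.sum_congr rfl fun d _ => ?_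
      rw [Equiv.coe_mulLeft, inv_mul_cancel_left]
    rw [Finset.sum_congr rfl fun c _ => hf c, Finset.sum_comm]
    refine Finset.sum_congr rfl fun τ _ => ?_
    rw [Nfac, Finset.card_filter]
    split_ifs with h <;> simp [h]
  rw [h1, Nat.cast_sum, Finset.sum_congr rfl fun τ hτ => hN τ (Finset.mem_filter.mp hτ).2,
    Finset.sum_const, count_invol hm hn, nsmul_eq_mul, mul_div_assoc]

theorem count_pairs_of_cycles_with_involution_product (g : ℕ) (hg : 2 ≤ g) :
    (Nat.card {p : Equiv.Perm (Fin (4 * g - 4)) × Equiv.Perm (Fin (4 * g - 4)) //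
        IsFullCycle p.1 ∧ IsFullCycle p.2 ∧
          (p.1 * p.2).cycleType = Multiset.replicate (2 * g - 2) 2} : ℚ) =
      (Nat.doubleFactorial (4 * g - 5) : ℚ) * (Nat.factorial (4 * g - 5) : ℚ) /
        (2 * g - 1) := by
  have h := count_general (4 * g - 4) (2 * g - 2) (by omega) ⟨g - 1, by omega⟩ (by omega)
  have h5 : 4 * g - 4 - 1 = 4 * g - 5 := by omega
  have hc : ((2 * g - 2 : ℕ) : ℝ) + 1 = 2 * g - 1 := by
    rw [Nat.cast_sub (by omega)]; push_cast; ring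
  rw [h5, hc] at h
  exact_mod_cast h
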